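/- arXiv:1912.03786 — 5 statements merged into one kernel-verified Lean document; each statement's English description precedes it below -/
import Mathlib

section
/- Let T be a jump distribution with exponential tails, let F(λ) := E[e^{λT}] denote its moment generating function, and let a := sup{λ ≥ 0 : F(λ) < ∞}. Then a > 0, and for every p with 0 < p < 1 − 1/𝓛(T) (interpreted as 0 < p < 1 when 𝓛(T) = ∞) there exists a unique b ∈ (0, a) such that (1−p)·F(b) = 1. -/
open MeasureTheory ProbabilityTheory

/-- The moment generating function `F(l) = E[e^{l·T}]`, as an extended nonnegative real. -/
noncomputable def mgfL {Ω : Type*} [MeasurableSpace Ω] (μ : Measure Ω) (T : Ω → ℝ) (l : ℝ) :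
    ENNReal := ∫⁻ ω, ENNReal.ofReal (Real.exp (l * T ω)) ∂μ

/-- `𝓛(T) := sup { E[e^{λT}] : λ > 0, E[e^{λT}] < ∞ }`, as an extended nonnegative real. -/
noncomputable def Lsup {Ω : Type*} [MeasurableSpace Ω] (μ : Measure Ω) (T : Ω → ℝ) : ENNReal :=
  ⨆ (l : ℝ) (_ : 0 < l) (_ : mgfL μ T l < ⊤), mgfL μ T l

/-- `a := sup {λ ≥ 0 : F(λ) < ∞}`, as an extended nonnegative real. -/
noncomputable def mgfRadius {Ω : Type*} [MeasurableSpace Ω] (μ : Measure Ω) (T : Ω → ℝ) :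
    ENNReal := ⨆ (l : ℝ) (_ : 0 ≤ l) (_ : mgfL μ T l < ⊤), ENNReal.ofReal l

theorem toReal_mgfL {Ω : Type*} [MeasurableSpace Ω] {μ : Measure Ω} {T : Ω → ℝ}
    (hT : Measurable T) (l : ℝ) : (mgfL μ T l).toReal = mgf T μ l := by
  rw [mgf, integral_eq_lintegral_of_nonneg_ae (.of_forall fun _ => (Real.exp_pos _).le)
    (by fun_prop)]
  rfl

theorem integrable_exp_mul_of_mgfL_lt_top {Ω : Type*} [MeasurableSpace Ω] {μ : Measure Ω}
    {T : Ω → ℝ} (hT : Measurable T) {l : ℝ} (h : mgfL μ T l < ⊤) :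
    Integrable (fun ω => Real.exp (l * T ω)) μ := by
  refine ⟨by fun_prop, ?_⟩
  rwa [hasFiniteIntegral_iff_ofReal (.of_forall fun _ => (Real.exp_pos _).le)]

theorem mgfL_lt_mgfL {Ω : Type*} [MeasurableSpace Ω] {μ : Measure Ω} [NeZero μ]
    {T : Ω → ℝ} (hT : Measurable T) (hTpos : ∀ᵐ ω ∂μ, 0 < T ω) {x y : ℝ} (hxy : x < y)
    (hx : mgfL μ T x < ⊤) : mgfL μ T x < mgfL μ T y := by
  refine lintegral_strict_mono (NeZero.ne μ) (by fun_prop) hx.ne ?_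
  filter_upwards [hTpos] with ω h
  exact (ENNReal.ofReal_lt_ofReal_iff (Real.exp_pos _)).2
    (Real.exp_lt_exp.2 (mul_lt_mul_of_pos_right hxy h))

theorem continuousOn_mgf_Iic {Ω : Type*} [MeasurableSpace Ω] {μ : Measure Ω}
    {T : Ω → ℝ} (hT : Measurable T) (hTpos : ∀ᵐ ω ∂μ, 0 < T ω) {l : ℝ}
    (h : mgfL μ T l < ⊤) : ContinuousOn (mgf T μ) (Set.Iic l) := by
  refine continuousOn_of_dominated (bound := fun ω => Real.exp (l * T ω)) ?_ ?_
    (integrable_exp_mul_of_mgfL_lt_top hT h) ?_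
  · intro x _
    fun_prop
  · intro x hx
    filter_upwards [hTpos] with ω hω
    rw [Real.norm_of_nonneg (Real.exp_pos _).le]
    exact Real.exp_le_exp.2 (mul_le_mul_of_nonneg_right hx hω.le)
  · refine .of_forall fun ω => ?_
    fun_prop

theorem mgfL_lt_top_of_exponential_tail {Ω : Type*} [MeasurableSpace Ω] {μ : Measure Ω}
    [IsFiniteMeasure μ] {T : Ω → ℝ} (hT : Measurable T) (hTpos : ∀ᵐ ω ∂μ, 0 < T ω)
    {C c l : ℝ} (hC : 0 ≤ C) (hl : 0 ≤ l) (hlc : l < c)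
    (htail : ∀ t ≥ (0:ℝ), (μ {ω | t ≤ T ω}).toReal ≤ C * Real.exp (-c * t)) :
    mgfL μ T l < ⊤ := by
  have hmeas (n : ℕ) : MeasurableSet {ω | (n : ℝ) ≤ T ω} := measurableSet_le measurable_const hT
  calc mgfL μ T l
      ≤ ∫⁻ ω, ∑' n : ℕ, {ω | (n : ℝ) ≤ T ω}.indicator
          (fun _ => ENNReal.ofReal (Real.exp (l * (n + 1)))) ω ∂μ := by
        refine lintegral_mono_ae ?_
        filter_upwards [hTpos] with ω hω
        refine le_trans ?_ (ENNReal.le_tsum ⌊T ω⌋₊)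
        have hmem : ω ∈ {ω' | (⌊T ω⌋₊ : ℝ) ≤ T ω'} := Nat.floor_le hω.le
        rw [Set.indicator_of_mem hmem]
        exact ENNReal.ofReal_le_ofReal (Real.exp_le_exp.2
          (mul_le_mul_of_nonneg_left (Nat.lt_floor_add_one _).le hl))
    _ = ∑' n : ℕ, ENNReal.ofReal (Real.exp (l * (n + 1))) * μ {ω | (n : ℝ) ≤ T ω} := by
        rw [lintegral_tsum fun n => (measurable_const.indicator (hmeas n)).aemeasurable]
        exact tsum_congr fun n => lintegral_indicator_const (hmeas n) _
    _ ≤ ∑' n : ℕ, ENNReal.ofReal (C * Real.exp l * Real.exp (l - c) ^ n) := by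
        refine ENNReal.tsum_le_tsum fun n => ?_
        rw [← ENNReal.ofReal_toReal (measure_ne_top μ {ω | (n : ℝ) ≤ T ω}),
          ← ENNReal.ofReal_mul (Real.exp_pos _).le]
        refine ENNReal.ofReal_le_ofReal
          ((mul_le_mul_of_nonneg_left (htail n n.cast_nonneg) (Real.exp_pos _).le).trans_eq ?_)
        rw [← Real.exp_nat_mul, mul_left_comm, ← Real.exp_add, mul_assoc, ← Real.exp_add]
        ring_nf
    _ < ⊤ := by
        have hsum : Summable fun n : ℕ => C * Real.exp l * Real.exp (l - c) ^ n :=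
          (summable_geometric_of_lt_one (Real.exp_pos _).le
            (Real.exp_lt_one_iff.2 (sub_neg.2 hlc))).mul_left _
        rw [← ENNReal.ofReal_tsum_of_nonneg (fun n => by positivity) hsum]
        exact ENNReal.ofReal_lt_top

/-- For a jump distribution `T` with exponential tails,
`a = sup {λ ≥ 0 : E[e^{λT}] < ∞}` is positive, and for every `0 < p < 1 − 1/𝓛(T)` there is a
unique `b ∈ (0, a)` with `(1 − p)·E[e^{bT}] = 1`. -/
theorem unique_exponential_tilt
    {Ω : Type*} [MeasurableSpace Ω] (μ : Measure Ω) [IsProbabilityMeasure μ]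
    (T : Ω → ℝ) (hT : Measurable T) (hTpos : ∀ᵐ ω ∂μ, 0 < T ω)
    (hexp : ∃ C c : ℝ, 0 < C ∧ 0 < c ∧
      ∀ t ≥ (0:ℝ), (μ {ω | t ≤ T ω}).toReal ≤ C * Real.exp (-c * t)) :
    0 < mgfRadius μ T ∧
    ∀ p : ℝ, 0 < p → ENNReal.ofReal p < 1 - (Lsup μ T)⁻¹ →
      ∃! b : ℝ, 0 < b ∧ ENNReal.ofReal b < mgfRadius μ T ∧
        (1 - p) * (mgfL μ T b).toReal = 1 := by
  refine ⟨?_, fun p hp hpL => ?_⟩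
  · obtain ⟨C, c, hC, hc, htail⟩ := hexp
    have hfin := mgfL_lt_top_of_exponential_tail hT hTpos hC.le (half_pos hc).le
      (half_lt_self hc) htail
    exact (ENNReal.ofReal_pos.2 (half_pos hc)).trans_le
      (le_iSup₂_of_le (c / 2) (half_pos hc).le (le_iSup_of_le hfin le_rfl))
  have hp1 : p < 1 := by
    have := hpL.trans_le tsub_le_self
    rwa [ENNReal.ofReal_lt_one] at this
  have hq : 0 < 1 - p := sub_pos.2 hp1
  have hL : ENNReal.ofReal (1 - p)⁻¹ < Lsup μ T := by
    rw [ENNReal.ofReal_inv_of_pos hq, ENNReal.inv_lt_iff_inv_lt,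
      ENNReal.ofReal_sub _ hp.le, ENNReal.ofReal_one]
    rw [lt_tsub_iff_left] at hpL ⊢
    rwa [add_comm] at hpL
  obtain ⟨l, hl0, hlfin, hl⟩ : ∃ l : ℝ, 0 < l ∧ mgfL μ T l < ⊤ ∧
      ENNReal.ofReal (1 - p)⁻¹ < mgfL μ T l := by
    simpa only [Lsup, lt_iSup_iff, exists_prop] using hL
  have hl' : (1 - p)⁻¹ < mgf T μ l := by
    rw [← toReal_mgfL hT]
    exact (ENNReal.ofReal_lt_iff_lt_toReal (inv_pos.2 hq).le hlfin.ne).1 hl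
  have h0 : mgf T μ 0 < (1 - p)⁻¹ := by
    rw [mgf_zero]
    exact (one_lt_inv₀ hq).2 (by linarith)
  obtain ⟨b, ⟨hb0, hbl⟩, hb⟩ := intermediate_value_Ioo hl0.le
    ((continuousOn_mgf_Iic hT hTpos hlfin).mono Set.Icc_subset_Iic_self) ⟨h0, hl'⟩
  have hfinite {x : ℝ} (hx : (1 - p) * (mgfL μ T x).toReal = 1) : mgfL μ T x < ⊤ := by
    rw [lt_top_iff_ne_top]
    intro h
    simp [h] at hx
  have hb1 : (1 - p) * (mgfL μ T b).toReal = 1 := by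
    rw [toReal_mgfL hT, hb, mul_inv_cancel₀ hq.ne']
  refine ⟨b, ⟨hb0, ?_, hb1⟩, ?_⟩
  · exact ((ENNReal.ofReal_lt_ofReal_iff hl0).2 hbl).trans_le
      (le_iSup₂_of_le l hl0.le (le_iSup_of_le hlfin le_rfl))
  · rintro x ⟨-, -, hx⟩
    have heq : mgfL μ T x = mgfL μ T b :=
      (ENNReal.toReal_eq_toReal_iff' (hfinite hx).ne (hfinite hb1).ne).1
        (mul_left_cancel₀ hq.ne' (hx.trans hb1.symm))
    rcases lt_trichotomy x b with h | h | h
    · exact absurd heq (mgfL_lt_mgfL hT hTpos h (hfinite hx)).ne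
    · exact h
    · exact absurd heq (mgfL_lt_mgfL hT hTpos h (hfinite hb1)).ne'
end

section
/- Let T be a jump distribution and k ≥ 1 an integer, and suppose the k-th convolution power σ of T has an absolutely continuous component of total mass ε > 0 in its Lebesgue decomposition. If A ⊆ ℝ is a measurable set with ℙ(T ∈ A) > (1−ε)^{1/k}, then the k-th convolution power of T|_A is non-singular, i.e., the distribution of the sum of k independent copies of T|_A has a non-zero absolutely continuous component with respect to Lebesgue measure. -/
open MeasureTheory ProbabilityTheory

/-- The `k`-th convolution power of a measure on `ℝ`: the law of the sum of `k` independent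
copies. -/
noncomputable def convPow (ν : Measure ℝ) (k : ℕ) : Measure ℝ :=
  Measure.map (fun x : Fin k → ℝ => ∑ i, x i) (Measure.pi fun _ : Fin k => ν)

/-- The product of `k` copies of a conditional law is the conditional law of the product. -/
theorem pi_cond_eq_smul_restrict (ν : Measure ℝ) [IsProbabilityMeasure ν] (k : ℕ)
    {A : Set ℝ} (hA : MeasurableSet A) (hA0 : ν A ≠ 0) :
    Measure.pi (fun _ : Fin k => ProbabilityTheory.cond ν A) =
      ((ν A)⁻¹ ^ k) • (Measure.pi fun _ : Fin k => ν).restrict (Set.univ.pi fun _ => A) := by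
  have := cond_isProbabilityMeasure hA0
  refine Measure.pi_eq fun s hs => ?_
  rw [Measure.smul_apply, Measure.restrict_apply (MeasurableSet.univ_pi hs),
    ← Set.pi_inter_distrib, Measure.pi_pi, smul_eq_mul]
  simp only [cond_apply hA, Finset.prod_mul_distrib, Finset.prod_const, Finset.card_univ,
    Fintype.card_fin, Set.inter_comm A]

/-- If the convolution power of the conditional law is singular, then the absolutely continuous
part of the convolution power of the full law is carried by the event that some jump
leaves `A`. -/
theorem withDensity_rnDeriv_convPow_univ_le (ν : Measure ℝ) [IsProbabilityMeasure ν] (k : ℕ)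
    {A : Set ℝ} (hA : MeasurableSet A) (hA0 : ν A ≠ 0)
    (h : (convPow (ProbabilityTheory.cond ν A) k).MutuallySingular volume) :
    (volume.withDensity ((convPow ν k).rnDeriv volume)) Set.univ ≤ 1 - ν A ^ k := by
  obtain ⟨s, hs, hs0, hsc⟩ := h
  have hsum : Measurable fun x : Fin k → ℝ => ∑ i, x i := by fun_prop
  have hB : MeasurableSet (Set.univ.pi fun _ : Fin k => A) :=
    MeasurableSet.univ_pi fun _ => hA
  rw [convPow, Measure.map_apply hsum hs, pi_cond_eq_smul_restrict ν k hA hA0,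
    Measure.smul_apply, smul_eq_mul, Measure.restrict_apply (hsum hs)] at hs0
  have hc : (ν A)⁻¹ ^ k ≠ 0 := pow_ne_zero _ (ENNReal.inv_ne_zero.2 (measure_ne_top _ _))
  have hnull := (mul_eq_zero.1 hs0).resolve_left hc
  set ρ := volume.withDensity ((convPow ν k).rnDeriv volume)
  calc ρ Set.univ = ρ (s ∪ sᶜ) := by rw [Set.union_compl_self]
    _ ≤ ρ s + ρ sᶜ := measure_union_le _ _
    _ = ρ s := by rw [withDensity_absolutelyContinuous volume _ hsc, add_zero]
    _ ≤ convPow ν k s := Measure.withDensity_rnDeriv_le _ _ s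
    _ = Measure.pi (fun _ : Fin k => ν) ((fun x : Fin k → ℝ => ∑ i, x i) ⁻¹' s) :=
      Measure.map_apply hsum hs
    _ ≤ Measure.pi (fun _ : Fin k => ν) (Set.univ.pi fun _ => A)ᶜ := by
      rw [← measure_inter_add_sdiff _ hB, hnull, zero_add]
      exact measure_mono fun x hx => hx.2
    _ = 1 - ν A ^ k := by
      rw [prob_compl_eq_one_sub hB, Measure.pi_pi]
      simp

/-- Let `T` be a jump distribution (law `ν` concentrated on `(0,∞)`), `k ≥ 1`,
and suppose the `k`-th convolution power `σ` of `ν` has an absolutely continuous component of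
total mass `ε > 0` in its Lebesgue decomposition. If `A` is measurable with
`ℙ(T ∈ A) > (1−ε)^{1/k}`, then the `k`-th convolution power of the conditional law `T|_A` is
non-singular, i.e. not mutually singular with Lebesgue measure. -/
theorem conditioned_convolution_power_nonsingular
    (ν : Measure ℝ) [IsProbabilityMeasure ν] (hν : ν (Set.Ioi 0) = 1)
    (k : ℕ) (hk : 1 ≤ k) (ε : ℝ)
    (hε : (volume.withDensity ((convPow ν k).rnDeriv volume)) Set.univ = ENNReal.ofReal ε)
    (hε0 : 0 < ε)
    (A : Set ℝ) (hA : MeasurableSet A)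
    (hAgt : (ν A).toReal > (1 - ε) ^ ((1 : ℝ) / k)) :
    ¬ (convPow (ProbabilityTheory.cond ν A) k).MutuallySingular volume := by
  have hsum : Measurable fun x : Fin k → ℝ => ∑ i, x i := by fun_prop
  have hprob : IsProbabilityMeasure (convPow ν k) :=
    Measure.isProbabilityMeasure_map hsum.aemeasurable
  have hε1 : ε ≤ 1 := by
    rw [← ENNReal.ofReal_le_one, ← hε]
    exact (Measure.withDensity_rnDeriv_le _ _ _).trans prob_le_one
  have hpos : 0 < (ν A).toReal :=
    (Real.rpow_nonneg (sub_nonneg.2 hε1) _).trans_lt hAgt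
  have hA0 : ν A ≠ 0 := fun h0 => by simp [h0] at hpos
  intro h
  have hle := withDensity_rnDeriv_convPow_univ_le ν k hA hA0 h
  rw [hε, ENNReal.ofReal_le_iff_le_toReal (by finiteness),
    ENNReal.toReal_sub_of_le (pow_le_one₀ zero_le prob_le_one) ENNReal.one_ne_top,
    ENNReal.toReal_pow, ENNReal.toReal_one] at hle
  have hk0 : k ≠ 0 := Nat.one_le_iff_ne_zero.1 hk
  refine hAgt.not_ge ?_
  calc (ν A).toReal = ((ν A).toReal ^ k) ^ ((1 : ℝ) / k) := by
        rw [one_div, Real.pow_rpow_inv_natCast hpos.le hk0]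
    _ ≤ (1 - ε) ^ ((1 : ℝ) / k) :=
        Real.rpow_le_rpow (by positivity) (by linarith) (by positivity)
end

section
/- Let T be a jump distribution that is absolutely continuous with density f, and let λ > 0 be such that f(t) ≥ λ·ℙ(T > t) for Lebesgue-almost every t ≥ 0 (for instance, λ < inf_{t ≥ 0} f(t)/ℙ(T > t) when this infimum is positive). Then the function g(t) := ℙ(T > t)·e^{λt} is non-increasing on [0,∞). Consequently there exists a random variable T₂ with values in (0,∞] whose law is determined by ℙ(T₂ > t) = ℙ(T > t)·e^{λt} for all t > 0, and if T₁ is an exponential random variable with rate λ independent of T₂, then min{T₁, T₂} has the same distribution as T. -/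
open MeasureTheory ProbabilityTheory

/-- Iterating the one-step bound `(1 + l (b - a)) G b ≤ G a` over finer and finer subdivisions
gives exponential decay of `G`. -/
theorem antitoneOn_mul_exp_of_one_add_mul_le {G : ℝ → ℝ} {l : ℝ} (hl : 0 ≤ l)
    (hG : ∀ a b, 0 ≤ a → a ≤ b → (1 + l * (b - a)) * G b ≤ G a) :
    AntitoneOn (fun t => G t * Real.exp (l * t)) (Set.Ici 0) := by
  intro a ha b _ hab
  have ha : 0 ≤ a := ha
  have hiter : ∀ (d : ℝ), 0 ≤ d → ∀ (n : ℕ) (a : ℝ), 0 ≤ a →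
      (1 + l * d) ^ n * G (a + n * d) ≤ G a := by
    intro d hd n
    induction n with
    | zero => intro a _; simp
    | succ n ih =>
      intro a ha
      have h1 := ih (a + d) (by positivity)
      have h2 := hG a (a + d) ha (by linarith)
      have h3 : a + d + n * d = a + (n + 1 : ℕ) * d := by push_cast; ring
      rw [h3] at h1
      calc (1 + l * d) ^ (n + 1) * G (a + (n + 1 : ℕ) * d)
          = (1 + l * d) * ((1 + l * d) ^ n * G (a + (n + 1 : ℕ) * d)) := by ring
        _ ≤ (1 + l * d) * G (a + d) := by gcongr
        _ ≤ G a := by simpa using h2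
  have hlim : Real.exp (l * (b - a)) * G b ≤ G a := by
    refine le_of_tendsto ((Real.tendsto_one_add_div_pow_exp (l * (b - a))).mul_const (G b)) ?_
    filter_upwards [Filter.eventually_gt_atTop 0] with n hn
    have hn' : (n : ℝ) ≠ 0 := by positivity
    have h := hiter ((b - a) / n) (div_nonneg (by linarith) (by positivity)) n a ha
    rwa [mul_div_cancel₀ _ hn', add_sub_cancel, ← mul_div_assoc] at h
  calc G b * Real.exp (l * b)
      = Real.exp (l * (b - a)) * G b * Real.exp (l * a) := by
        rw [show l * b = l * (b - a) + l * a by ring, Real.exp_add]; ring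
    _ ≤ G a * Real.exp (l * a) := by gcongr

/-- A right-continuous non-increasing function on `[0, ∞)` starting at `1` is the tail of a
probability law on `(0, ∞]`. -/
theorem exists_probabilityMeasure_ennreal_tail_eq {g : ℝ → ℝ} (hg : AntitoneOn g (Set.Ici 0))
    (hg0 : g 0 = 1) (hrc : ∀ t, ContinuousWithinAt g (Set.Ici t) t) :
    ∃ ν : Measure ENNReal, IsProbabilityMeasure ν ∧ ν {0} = 0 ∧
      ∀ t : ℝ, 0 ≤ t → ν {x | ENNReal.ofReal t < x} = ENNReal.ofReal (g t) := by
  let Q : ℝ → ENNReal := fun u => sSup (ENNReal.ofReal '' {t | 0 ≤ t ∧ u < g t})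
  have hQ : Antitone Q := fun u v huv =>
    sSup_le_sSup (Set.image_mono fun t ht => ⟨ht.1, huv.trans_lt ht.2⟩)
  have hQm : Measurable Q := hQ.measurable
  have hlt : ∀ t, 0 ≤ t → ∀ u, ENNReal.ofReal t < Q u ↔ u < g t := by
    intro t ht u
    simp only [Q, lt_sSup_iff, Set.exists_mem_image, Set.mem_ofPred_eq]
    constructor
    · rintro ⟨s, ⟨hs, hus⟩, hts⟩
      have hts' : t < s := (ENNReal.ofReal_lt_ofReal_iff_of_nonneg ht).1 hts
      exact hus.trans_le (hg ht hs hts'.le)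
    · intro hu
      have h1 : ∀ᶠ s in nhdsWithin t (Set.Ioi t), u < g s :=
        ((hrc t).mono Set.Ioi_subset_Ici_self).eventually (lt_mem_nhds hu)
      obtain ⟨s, hs, hts⟩ := (h1.and self_mem_nhdsWithin).exists
      have hts : t < s := hts
      exact ⟨s, ⟨ht.trans hts.le, hs⟩, (ENNReal.ofReal_lt_ofReal_iff_of_nonneg ht).2 hts⟩
  have hP : IsProbabilityMeasure (volume.restrict (Set.Ico (0 : ℝ) 1)) := ⟨by simp⟩
  have htail : ∀ t : ℝ, 0 ≤ t → ((volume.restrict (Set.Ico (0 : ℝ) 1)).map Q)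
      {x | ENNReal.ofReal t < x} = ENNReal.ofReal (g t) := by
    intro t ht
    have hS : MeasurableSet {x | ENNReal.ofReal t < x} := measurableSet_Ioi
    rw [Measure.map_apply hQm hS]
    have h1 : Q ⁻¹' {x | ENNReal.ofReal t < x} = Set.Iio (g t) := by
      ext u; exact hlt t ht u
    have h2 : g t ≤ 1 := hg0 ▸ hg Set.self_mem_Ici ht ht
    have h3 : Set.Iio (g t) ∩ Set.Ico 0 1 = Set.Ico 0 (g t) := by
      ext u
      simp only [Set.mem_inter_iff, Set.mem_Iio, Set.mem_Ico]
      constructor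
      · rintro ⟨h, h', _⟩; exact ⟨h', h⟩
      · rintro ⟨h, h'⟩; exact ⟨h', h, h'.trans_le h2⟩
    rw [h1, Measure.restrict_apply measurableSet_Iio, h3, Real.volume_Ico, sub_zero]
  have hν : IsProbabilityMeasure ((volume.restrict (Set.Ico (0 : ℝ) 1)).map Q) :=
    Measure.isProbabilityMeasure_map hQm.aemeasurable
  refine ⟨_, hν, ?_, htail⟩
  have h0 := htail 0 le_rfl
  have hc : {x : ENNReal | ENNReal.ofReal 0 < x} = {0}ᶜ := by
    ext x; simp [pos_iff_ne_zero]
  rwa [hc, hg0, ENNReal.ofReal_one, prob_compl_eq_one_iff (measurableSet_singleton 0)] at h0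

theorem continuousWithinAt_Ici_tail {Ω : Type*} [MeasurableSpace Ω] (μ : Measure Ω)
    [IsProbabilityMeasure μ] {T : Ω → ℝ} (hT : Measurable T) (t : ℝ) :
    ContinuousWithinAt (fun t => (μ {ω | t < T ω}).toReal) (Set.Ici t) t := by
  have hP : IsProbabilityMeasure (μ.map T) := Measure.isProbabilityMeasure_map hT.aemeasurable
  have h : (fun t => (μ {ω | t < T ω}).toReal) = fun t => 1 - cdf (μ.map T) t := by
    funext t
    have h1 : μ.real {ω | t < T ω} = (μ.map T).real (Set.Iic t)ᶜ := by
      rw [map_measureReal_apply hT measurableSet_Iic.compl]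
      congr 1
      ext ω
      simp
    rw [cdf_eq_real, ← probReal_compl_eq_one_sub measurableSet_Iic, ← h1, Measure.real]
  rw [h]
  exact continuousWithinAt_const.sub ((cdf (μ.map T)).right_continuous t)

/-- If the density of `T` dominates `l` times its tail, then the tail decreases at relative rate
at least `l`. -/
theorem one_add_mul_tail_le_of_density_ge {Ω : Type*} [MeasurableSpace Ω] (μ : Measure Ω)
    [IsProbabilityMeasure μ] {T : Ω → ℝ} (hT : Measurable T) {f : ℝ → ℝ}
    (hd : Measure.map T μ = volume.withDensity fun s => ENNReal.ofReal (f s))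
    {l : ℝ} (hl : 0 ≤ l)
    (hfl : ∀ᵐ t ∂(volume.restrict (Set.Ici (0 : ℝ))), l * (μ {ω | t < T ω}).toReal ≤ f t)
    {a b : ℝ} (ha : 0 ≤ a) (hab : a ≤ b) :
    (1 + l * (b - a)) * (μ {ω | b < T ω}).toReal ≤ (μ {ω | a < T ω}).toReal := by
  have hIoc : ENNReal.ofReal (l * (μ {ω | b < T ω}).toReal) * ENNReal.ofReal (b - a)
      ≤ μ {ω | a < T ω ∧ T ω ≤ b} := by
    have h1 : μ {ω | a < T ω ∧ T ω ≤ b} = μ.map T (Set.Ioc a b) := by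
      rw [Measure.map_apply hT measurableSet_Ioc]; rfl
    rw [h1, hd, withDensity_apply _ measurableSet_Ioc, ← Real.volume_Ioc, ← setLIntegral_const]
    refine lintegral_mono_ae ?_
    have hsub : Set.Ioc a b ⊆ Set.Ici 0 := fun x hx => ha.trans hx.1.le
    filter_upwards [ae_restrict_of_ae_restrict_of_subset hsub hfl,
      ae_restrict_mem measurableSet_Ioc] with t ht htm
    refine ENNReal.ofReal_le_ofReal (le_trans ?_ ht)
    gcongr
    · exact measure_ne_top _ _
    · exact htm.2
  have hsplit : μ.real {ω | a < T ω} = μ.real {ω | a < T ω ∧ T ω ≤ b} + μ.real {ω | b < T ω} := by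
    rw [← measureReal_union _ (measurableSet_lt measurable_const hT)]
    · congr 1
      ext ω
      simp only [Set.mem_ofPred_eq, Set.mem_union]
      grind
    · rw [Set.disjoint_left]
      rintro ω ⟨_, h⟩ h'
      exact absurd h' (not_lt.2 h)
  rw [← ENNReal.ofReal_mul (by positivity)] at hIoc
  have h2 := (ENNReal.ofReal_le_iff_le_toReal (measure_ne_top _ _)).1 hIoc
  simp only [Measure.real] at hsplit
  rw [hsplit]
  linarith

/-- A law on `[0, ∞]` is determined by its tail at finite points. -/
theorem measure_ennreal_ext_of_tail {ν ρ : Measure ENNReal} [IsProbabilityMeasure ν]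
    [IsProbabilityMeasure ρ] (h : ∀ t : ℝ, 0 ≤ t →
      ν {x | ENNReal.ofReal t < x} = ρ {x | ENNReal.ofReal t < x}) : ν = ρ := by
  refine Measure.ext_of_Iic _ _ fun x => ?_
  rcases eq_or_ne x ⊤ with rfl | hx
  · simp
  · have h1 := h x.toReal ENNReal.toReal_nonneg
    rw [ENNReal.ofReal_toReal hx] at h1
    rw [← Set.compl_Ioi, prob_compl_eq_one_sub measurableSet_Ioi,
      prob_compl_eq_one_sub measurableSet_Ioi]
    exact congrArg (1 - ·) h1

/-- Let `T` be a jump distribution, absolutely continuous with density `f`, and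
let `λ > 0` be such that `f t ≥ λ·ℙ(T > t)` for Lebesgue-a.e. `t ≥ 0`. Then
`t ↦ ℙ(T > t)·e^{λt}` is non-increasing on `[0,∞)`; consequently there is a random variable `T₂`
with values in `(0,∞]` (formalized as a probability law `ν` on `ℝ≥0∞` with `ν {0} = 0`) whose
tail is `ℙ(T₂ > t) = ℙ(T > t)·e^{λt}` for `t > 0`, and for any exponential(`λ`) variable `T₁`
independent of such a `T₂`, `min {T₁, T₂}` has the same distribution as `T`. -/
theorem exponential_minorant_splitting
    {Ω : Type*} [MeasurableSpace Ω] (μ : Measure Ω) [IsProbabilityMeasure μ]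
    (T : Ω → ℝ) (hT : Measurable T) (hTpos : ∀ᵐ ω ∂μ, 0 < T ω)
    (f : ℝ → ℝ) (hf : Measurable f)
    (hd : Measure.map T μ = volume.withDensity fun s => ENNReal.ofReal (f s))
    (l : ℝ) (hl : 0 < l)
    (hfl : ∀ᵐ t ∂(volume.restrict (Set.Ici (0:ℝ))), l * (μ {ω | t < T ω}).toReal ≤ f t) :
    AntitoneOn (fun t => (μ {ω | t < T ω}).toReal * Real.exp (l * t)) (Set.Ici 0) ∧
    (∃ ν : Measure ENNReal, IsProbabilityMeasure ν ∧ ν {0} = 0 ∧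
      ∀ t : ℝ, 0 < t →
        ν {x | ENNReal.ofReal t < x} = μ {ω | t < T ω} * ENNReal.ofReal (Real.exp (l * t))) ∧
    (∀ (Ω' : Type) [MeasurableSpace Ω'] (μ' : Measure Ω') [IsProbabilityMeasure μ']
        (T₁ : Ω' → ℝ) (T₂ : Ω' → ENNReal), Measurable T₁ → Measurable T₂ →
        (∀ t ≥ (0:ℝ), μ' {ω | t < T₁ ω} = ENNReal.ofReal (Real.exp (-(l * t)))) →
        (∀ t : ℝ, 0 < t →
          μ' {ω | ENNReal.ofReal t < T₂ ω}
            = μ {ω | t < T ω} * ENNReal.ofReal (Real.exp (l * t))) →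
        IndepFun T₁ T₂ μ' →
        Measure.map (fun ω => min (ENNReal.ofReal (T₁ ω)) (T₂ ω)) μ'
          = Measure.map (fun ω => ENNReal.ofReal (T ω)) μ) := by
  set G : ℝ → ℝ := fun t => (μ {ω | t < T ω}).toReal with hGdef
  set g : ℝ → ℝ := fun t => G t * Real.exp (l * t) with hgdef
  have hanti : AntitoneOn g (Set.Ici 0) :=
    antitoneOn_mul_exp_of_one_add_mul_le hl.le fun a b ha hab =>
      one_add_mul_tail_le_of_density_ge μ hT hd hl.le hfl ha hab
  have hg0 : g 0 = 1 := by
    have h : μ {ω | 0 < T ω} = 1 :=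
      (mem_ae_iff_prob_eq_one (measurableSet_lt measurable_const hT)).1 hTpos
    simp [hgdef, hGdef, h]
  have hrc : ∀ t, ContinuousWithinAt g (Set.Ici t) t := fun t =>
    (continuousWithinAt_Ici_tail μ hT t).mul (by fun_prop)
  have hgE : ∀ t, μ {ω | t < T ω} * ENNReal.ofReal (Real.exp (l * t)) = ENNReal.ofReal (g t) := by
    intro t
    rw [ENNReal.ofReal_mul ENNReal.toReal_nonneg, ENNReal.ofReal_toReal (measure_ne_top _ _)]
  refine ⟨hanti, ?_, ?_⟩
  · obtain ⟨ν, hν, hν0, htail⟩ := exists_probabilityMeasure_ennreal_tail_eq hanti hg0 hrc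
    exact ⟨ν, hν, hν0, fun t ht => by rw [htail t ht.le, hgE]⟩
  · intro Ω' _ μ' _ T₁ T₂ hT₁ hT₂ h₁ h₂ hind
    have h₂' : ∀ t : ℝ, 0 ≤ t → μ' {ω | ENNReal.ofReal t < T₂ ω} = ENNReal.ofReal (g t) := by
      intro t ht
      rcases ht.eq_or_lt with rfl | ht
      · refine le_antisymm (by simpa [hg0] using prob_le_one) ?_
        have hlim : Filter.Tendsto (fun t => ENNReal.ofReal (g t)) (nhdsWithin 0 (Set.Ioi 0))
            (nhds (ENNReal.ofReal (g 0))) :=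
          (ENNReal.continuous_ofReal.tendsto _).comp ((hrc 0).mono Set.Ioi_subset_Ici_self)
        refine le_of_tendsto hlim ?_
        filter_upwards [self_mem_nhdsWithin] with s hs
        rw [← hgE, ← h₂ s hs]
        exact measure_mono fun ω hω =>
          (ENNReal.ofReal_le_ofReal (le_of_lt hs)).trans_lt hω
      · rw [h₂ t ht, hgE]
    have hmin : Measurable fun ω => min (ENNReal.ofReal (T₁ ω)) (T₂ ω) :=
      hT₁.ennreal_ofReal.min hT₂
    have hP := Measure.isProbabilityMeasure_map (μ := μ') hmin.aemeasurable
    have hP' := Measure.isProbabilityMeasure_map (μ := μ) hT.ennreal_ofReal.aemeasurable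
    refine measure_ennreal_ext_of_tail fun t ht => ?_
    have hS : MeasurableSet {x | ENNReal.ofReal t < x} := measurableSet_Ioi
    rw [Measure.map_apply hmin hS, Measure.map_apply hT.ennreal_ofReal hS]
    have hl' : (fun ω => min (ENNReal.ofReal (T₁ ω)) (T₂ ω)) ⁻¹' {x | ENNReal.ofReal t < x}
        = T₁ ⁻¹' Set.Ioi t ∩ T₂ ⁻¹' Set.Ioi (ENNReal.ofReal t) := by
      ext ω
      simp [ENNReal.ofReal_lt_ofReal_iff_of_nonneg ht]
    have hr : (fun ω => ENNReal.ofReal (T ω)) ⁻¹' {x | ENNReal.ofReal t < x} = {ω | t < T ω} := by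
      ext ω
      simp [ENNReal.ofReal_lt_ofReal_iff_of_nonneg ht]
    rw [hl', hr, hind.measure_inter_preimage_eq_mul _ _ measurableSet_Ioi measurableSet_Ioi]
    calc μ' {ω | t < T₁ ω} * μ' {ω | ENNReal.ofReal t < T₂ ω}
        = ENNReal.ofReal (Real.exp (-(l * t)) * g t) := by
          rw [h₁ t ht, h₂' t ht, ENNReal.ofReal_mul (Real.exp_nonneg _)]
      _ = ENNReal.ofReal (G t) := by
          rw [hgdef, Real.exp_neg]
          field_simp
      _ = μ {ω | t < T ω} := ENNReal.ofReal_toReal (measure_ne_top _ _)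
end

section
/- There exist independent random variables T₁ and T₂ taking values in [0,1], each with an atomless (continuous) distribution, together with Borel measurable functions φ₁, φ₂ : ℝ → ℝ such that T₁ = φ₁(T₁ + T₂) and T₂ = φ₂(T₁ + T₂) almost surely. (For example, T₁ can be obtained from a uniform random variable on [0,1] by setting all even-indexed bits of its binary expansion to 0, and T₂ similarly with all odd-indexed bits set to 0.) -/
open MeasureTheory ProbabilityTheory

/-- The sequence with even-indexed terms `a` and odd-indexed terms `b`. -/
def interleave (a b : ℕ → Bool) (n : ℕ) : Bool :=
  if n % 2 = 0 then a (n / 2) else b (n / 2)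

theorem interleave_injective :
    Function.Injective fun p : (ℕ → Bool) × (ℕ → Bool) => interleave p.1 p.2 := by
  rintro ⟨a, b⟩ ⟨a', b'⟩ h
  refine Prod.ext (funext fun n => ?_) (funext fun n => ?_)
  · simpa [interleave] using congrFun h (2 * n)
  · have h₁ : (2 * n + 1) / 2 = n := by omega
    simpa [interleave, Nat.add_mod, h₁] using congrFun h (2 * n + 1)

theorem measurable_interleave :
    Measurable fun p : (ℕ → Bool) × (ℕ → Bool) => interleave p.1 p.2 := by
  refine measurable_pi_lambda _ fun n => ?_
  unfold interleave
  split_ifs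
  · exact (measurable_pi_apply _).comp measurable_fst
  · exact (measurable_pi_apply _).comp measurable_snd

theorem continuous_cantorFunction {c : ℝ} (h₀ : 0 ≤ c) (h₁ : c < 1) :
    Continuous (Cardinal.cantorFunction c) := by
  refine continuous_tsum (u := fun n => c ^ n) (fun n => ?_)
    (summable_geometric_of_lt_one h₀ h₁) fun n f => ?_
  · exact (continuous_of_discreteTopology (f := fun x : Bool => cond x (c ^ n) 0)).comp
      (continuous_apply n)
  · have := pow_nonneg h₀ n
    cases h : f n <;> simp [Cardinal.cantorFunctionAux, h, abs_of_nonneg h₀, this]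

theorem cantorFunction_nonneg {c : ℝ} (h₀ : 0 ≤ c) (f : ℕ → Bool) :
    0 ≤ Cardinal.cantorFunction c f :=
  tsum_nonneg fun _ => Cardinal.cantorFunctionAux_nonneg h₀

theorem cantorFunction_le_inv {c : ℝ} (h₀ : 0 ≤ c) (h₁ : c < 1) (f : ℕ → Bool) :
    Cardinal.cantorFunction c f ≤ (1 - c)⁻¹ := by
  rw [← tsum_geometric_of_lt_one h₀ h₁]
  refine (Cardinal.summable_cantor_function f h₀ h₁).tsum_le_tsum (fun n => ?_)
    (summable_geometric_of_lt_one h₀ h₁)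
  have := pow_nonneg h₀ n
  cases h : f n <;> simp [Cardinal.cantorFunctionAux, h, this]

theorem cantorFunction_interleave {c : ℝ} (h₀ : 0 ≤ c) (h₁ : c < 1) (a b : ℕ → Bool) :
    Cardinal.cantorFunction c (interleave a fun _ => false) +
      Cardinal.cantorFunction c (interleave (fun _ => false) b) =
      Cardinal.cantorFunction c (interleave a b) := by
  unfold Cardinal.cantorFunction
  rw [← (Cardinal.summable_cantor_function _ h₀ h₁).tsum_add
    (Cardinal.summable_cantor_function _ h₀ h₁)]
  refine tsum_congr fun n => ?_
  by_cases hn : n % 2 = 0 <;> simp [Cardinal.cantorFunctionAux, interleave, hn]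

/-- There are measurable `F, G : ℝ → [0, 1]` for which `F x + G y` determines `(x, y)`. -/
theorem exists_measurable_injective_add :
    ∃ F G : ℝ → ℝ, Measurable F ∧ Measurable G ∧ (∀ x, F x ∈ Set.Icc (0 : ℝ) 1) ∧
      (∀ x, G x ∈ Set.Icc (0 : ℝ) 1) ∧
      Function.Injective fun p : ℝ × ℝ => F p.1 + G p.2 := by
  have not_countable_real : ¬ Countable ℝ := not_countable
  have not_countable_cantor : ¬ Countable (ℕ → Bool) := by
    rw [not_countable_iff, ← Cardinal.aleph0_lt_mk_iff]
    simpa using Cardinal.cantor Cardinal.aleph0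
  let e : ℝ ≃ᵐ (ℕ → Bool) :=
    PolishSpace.measurableEquivOfNotCountable not_countable_real not_countable_cantor
  have hc : Measurable (Cardinal.cantorFunction (1 / 4)) :=
    (continuous_cantorFunction (by norm_num) (by norm_num)).measurable
  have hmem (f : ℕ → Bool) : 1 / 2 * Cardinal.cantorFunction (1 / 4) f ∈ Set.Icc (0 : ℝ) 1 := by
    have h₀ := cantorFunction_nonneg (c := 1 / 4) (by norm_num) f
    have h₁ := cantorFunction_le_inv (c := 1 / 4) (by norm_num) (by norm_num) f
    norm_num at h₁
    constructor <;> linarith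
  refine ⟨fun x => 1 / 2 * Cardinal.cantorFunction (1 / 4) (interleave (e x) fun _ => false),
    fun y => 1 / 2 * Cardinal.cantorFunction (1 / 4) (interleave (fun _ => false) (e y)),
    ?_, ?_, fun _ => hmem _, fun _ => hmem _, ?_⟩
  · exact (hc.comp (measurable_interleave.comp
      (e.measurable.prodMk (measurable_const (a := fun _ => false))))).const_mul (1 / 2)
  · exact (hc.comp (measurable_interleave.comp
      ((measurable_const (a := fun _ => false)).prodMk e.measurable))).const_mul (1 / 2)
  · rintro ⟨x, y⟩ ⟨x', y'⟩ h
    simp only [← mul_add] at h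
    rw [cantorFunction_interleave (by norm_num) (by norm_num),
      cantorFunction_interleave (by norm_num) (by norm_num)] at h
    have h' := interleave_injective (a₁ := (e x, e y)) (a₂ := (e x', e y'))
      (Cardinal.cantorFunction_injective (c := 1 / 4) (by norm_num) (by norm_num)
        (mul_left_cancel₀ (by norm_num) h))
    simpa using h'

/-- An injective image of an atomless law is atomless. -/
theorem map_singleton_eq_zero_of_injective {Ω α β : Type*} [MeasurableSpace Ω]
    [MeasurableSpace α] [MeasurableSpace β] [MeasurableSingletonClass β]
    {μ : Measure Ω} {X : Ω → α} {f : α → β} (hX : Measurable X) (hf : Measurable f)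
    (hinj : Function.Injective f) [NullSingletonClass (μ.map X)] (y : β) :
    μ.map (fun ω => f (X ω)) {y} = 0 := by
  change μ.map (f ∘ X) {y} = 0
  rw [← Measure.map_map hf hX, Measure.map_apply hf (measurableSet_singleton y)]
  exact (Set.subsingleton_singleton.preimage hinj).measure_zero _

/-- There exist independent random variables `T₁, T₂` with values in `[0,1]`,
each with an atomless distribution, and Borel functions `φ₁, φ₂ : ℝ → ℝ` with
`T₁ = φ₁ (T₁ + T₂)` and `T₂ = φ₂ (T₁ + T₂)` almost surely. -/
theorem exists_independent_atomless_determined_by_sum :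
    ∃ (Ω : Type) (_ : MeasurableSpace Ω) (μ : Measure Ω),
      IsProbabilityMeasure μ ∧
      ∃ T₁ T₂ : Ω → ℝ, Measurable T₁ ∧ Measurable T₂ ∧
        (∀ᵐ ω ∂μ, T₁ ω ∈ Set.Icc (0:ℝ) 1) ∧ (∀ᵐ ω ∂μ, T₂ ω ∈ Set.Icc (0:ℝ) 1) ∧
        (∀ x : ℝ, Measure.map T₁ μ {x} = 0) ∧ (∀ x : ℝ, Measure.map T₂ μ {x} = 0) ∧
        IndepFun T₁ T₂ μ ∧
        ∃ φ₁ φ₂ : ℝ → ℝ, Measurable φ₁ ∧ Measurable φ₂ ∧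
          (∀ᵐ ω ∂μ, T₁ ω = φ₁ (T₁ ω + T₂ ω) ∧ T₂ ω = φ₂ (T₁ ω + T₂ ω)) := by
  obtain ⟨F, G, hF, hG, hF01, hG01, hinj⟩ := exists_measurable_injective_add
  let ν : Measure ℝ := volume.restrict (Set.Icc 0 1)
  have : IsProbabilityMeasure ν := ⟨by simp [ν]⟩
  have hFinj : Function.Injective F := fun x x' h =>
    congrArg Prod.fst (hinj (a₁ := (x, 0)) (a₂ := (x', 0)) (by simp [h]))
  have hGinj : Function.Injective G := fun y y' h =>
    congrArg Prod.snd (hinj (a₁ := (0, y)) (a₂ := (0, y')) (by simp [h]))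
  have hfst : (ν.prod ν).map Prod.fst = ν := by simp
  have hsnd : (ν.prod ν).map Prod.snd = ν := by simp
  have : NullSingletonClass ((ν.prod ν).map Prod.fst) := by rw [hfst]; infer_instance
  have : NullSingletonClass ((ν.prod ν).map Prod.snd) := by rw [hsnd]; infer_instance
  have hF₁ : Measurable fun p : ℝ × ℝ => F p.1 := hF.comp measurable_fst
  have hG₂ : Measurable fun p : ℝ × ℝ => G p.2 := hG.comp measurable_snd
  have hemb : MeasurableEmbedding fun p : ℝ × ℝ => F p.1 + G p.2 :=
    (hF₁.add hG₂).measurableEmbedding hinj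
  obtain ⟨φ₁, hφ₁, h₁⟩ := hemb.exists_measurable_extend hF₁ fun _ => ⟨0⟩
  obtain ⟨φ₂, hφ₂, h₂⟩ := hemb.exists_measurable_extend hG₂ fun _ => ⟨0⟩
  exact ⟨ℝ × ℝ, inferInstance, ν.prod ν, inferInstance, fun p => F p.1, fun p => G p.2,
    hF₁, hG₂, .of_forall fun _ => hF01 _, .of_forall fun _ => hG01 _,
    map_singleton_eq_zero_of_injective measurable_fst hF hFinj,
    map_singleton_eq_zero_of_injective measurable_snd hG hGinj,
    indepFun_prod hF hG, φ₁, φ₂, hφ₁, hφ₂,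
    .of_forall fun p => ⟨(congrFun h₁ p).symm, (congrFun h₂ p).symm⟩⟩
end

section
/- Let T be a jump distribution with exponential tails that is absolutely continuous with a continuous density g, and let d > 0 satisfy g(d) > 0. For d′ > d set A_{d′} := (d, d′) and p_{d′} := ℙ(T ∈ A_{d′}). Then for every γ ≥ 0 and every d′ > d with p_{d′} < 1, one has (E[e^{γT}] − p_{d′}·e^{γ d′})/(1−p_{d′}) ≤ E[e^{γ·T|_{A_{d′}^c}}] ≤ E[e^{γT}]/(1−p_{d′}), and consequently p_{d′} → 0 and 𝓛(T|_{A_{d′}^c}) → 𝓛(T) as d′ ↓ d. In particular there exists d′ > d with p_{d′} < 1 − 1/𝓛(T|_{A_{d′}^c}). -/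
open MeasureTheory ProbabilityTheory Filter

/-- The moment generating function `E[e^{l·X}]` of a law `ν` on `ℝ`, as an extended nonnegative
real. -/
noncomputable def mgfM (ν : Measure ℝ) (l : ℝ) : ENNReal :=
  ∫⁻ x, ENNReal.ofReal (Real.exp (l * x)) ∂ν

/-- `𝓛(ν) := sup { E[e^{λX}] : λ > 0, E[e^{λX}] < ∞ }` of a law `ν` on `ℝ`, as an extended
nonnegative real. -/
noncomputable def LsupM (ν : Measure ℝ) : ENNReal :=
  ⨆ (l : ℝ) (_ : 0 < l) (_ : mgfM ν l < ⊤), mgfM ν l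

lemma mgfM_cond (ν : Measure ℝ) (s : Set ℝ) (l : ℝ) :
    mgfM (ProbabilityTheory.cond ν s) l
      = (∫⁻ x in s, ENNReal.ofReal (Real.exp (l * x)) ∂ν) / ν s := by
  rw [mgfM, ProbabilityTheory.cond, lintegral_smul_measure, smul_eq_mul, mul_comm,
    ENNReal.div_eq_inv_mul, mul_comm]

lemma mgfM_cond_compl_le (ν : Measure ℝ) [IsProbabilityMeasure ν] {s : Set ℝ}
    (hs : MeasurableSet s) (l : ℝ) :
    mgfM (ProbabilityTheory.cond ν sᶜ) l ≤ mgfM ν l / (1 - ν s) := by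
  rw [mgfM_cond, prob_compl_eq_one_sub hs]
  exact ENNReal.div_le_div_right (setLIntegral_le_lintegral _ _) _

/-- If `s` lies in `(-∞, b]`, its contribution to the moment generating function at `l ≥ 0` is at
most `ν s * e^{lb}`. -/
lemma le_mgfM_cond_compl (ν : Measure ℝ) [IsProbabilityMeasure ν] {s : Set ℝ}
    (hs : MeasurableSet s) {b l : ℝ} (hb : ∀ x ∈ s, x ≤ b) (hl : 0 ≤ l) :
    (mgfM ν l - ν s * ENNReal.ofReal (Real.exp (l * b))) / (1 - ν s)
      ≤ mgfM (ProbabilityTheory.cond ν sᶜ) l := by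
  rw [mgfM_cond, prob_compl_eq_one_sub hs]
  refine ENNReal.div_le_div_right ?_ _
  rw [tsub_le_iff_left, mgfM, ← lintegral_add_compl _ hs]
  gcongr
  calc ∫⁻ x in s, ENNReal.ofReal (Real.exp (l * x)) ∂ν
      ≤ ∫⁻ _ in s, ENNReal.ofReal (Real.exp (l * b)) ∂ν :=
        setLIntegral_mono measurable_const fun x hx => by
          have := hb x hx
          gcongr
    _ = ν s * ENNReal.ofReal (Real.exp (l * b)) := by
        rw [setLIntegral_const, mul_comm]

lemma mgfM_le_LsupM {ν : Measure ℝ} {l : ℝ} (hl : 0 < l) (h : mgfM ν l < ⊤) :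
    mgfM ν l ≤ LsupM ν :=
  le_iSup_of_le l (le_iSup_of_le hl (le_iSup_of_le h le_rfl))

lemma LsupM_cond_compl_le (ν : Measure ℝ) [IsProbabilityMeasure ν] {s : Set ℝ}
    (hs : MeasurableSet s) {b : ℝ} (hb : ∀ x ∈ s, x ≤ b) :
    LsupM (ProbabilityTheory.cond ν sᶜ) ≤ LsupM ν / (1 - ν s) := by
  refine iSup_le fun l => iSup_le fun hl => iSup_le fun hfin => ?_
  refine (mgfM_cond_compl_le ν hs l).trans (ENNReal.div_le_div_right (mgfM_le_LsupM hl ?_) _)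
  by_contra! htop
  have h := le_mgfM_cond_compl ν hs hb hl.le
  rw [top_le_iff.1 htop, ENNReal.top_sub (ENNReal.mul_ne_top (measure_ne_top ν s)
    ENNReal.ofReal_ne_top), ENNReal.top_div_of_ne_top
      (ne_top_of_le_ne_top ENNReal.one_ne_top tsub_le_self)] at h
  exact hfin.ne (top_le_iff.1 h)

lemma tendsto_measure_Ioo_right (ν : Measure ℝ) [IsFiniteMeasure ν] (d : ℝ) :
    Tendsto (fun b => ν (Set.Ioo d b)) (nhdsWithin d (Set.Ioi d)) (nhds 0) := by
  have h := tendsto_measure_biInter_gt (μ := ν) (s := fun b => Set.Ioo d b) (a := d)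
    (fun b _ => measurableSet_Ioo.nullMeasurableSet)
    (fun i j _ hij => Set.Ioo_subset_Ioo_right hij) ⟨d + 1, by simp, measure_ne_top _ _⟩
  have he : (⋂ r > d, Set.Ioo d r) = ∅ := by
    refine Set.eq_empty_of_forall_notMem fun x hx => ?_
    simp only [Set.mem_iInter, Set.mem_Ioo] at hx
    have hdx := (hx (d + 1) (by simp)).1
    exact lt_irrefl x (hx x hdx).2
  rw [he, measure_empty] at h
  exact h

lemma tendsto_LsupM_cond_compl_Ioo (ν : Measure ℝ) [IsProbabilityMeasure ν] (d : ℝ) :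
    Tendsto (fun b => LsupM (ProbabilityTheory.cond ν (Set.Ioo d b)ᶜ))
      (nhdsWithin d (Set.Ioi d)) (nhds (LsupM ν)) := by
  have hp := tendsto_measure_Ioo_right ν d
  have hlt : ∀ᶠ b in nhdsWithin d (Set.Ioi d), ν (Set.Ioo d b) < 1 :=
    hp.eventually_lt_const zero_lt_one
  have hsub : Tendsto (fun b => 1 - ν (Set.Ioo d b)) (nhdsWithin d (Set.Ioi d)) (nhds 1) := by
    simpa using ENNReal.Tendsto.sub tendsto_const_nhds hp (Or.inl ENNReal.one_ne_top)
  refine tendsto_order.2 ⟨fun a ha => ?_, fun a ha => ?_⟩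
  · simp only [LsupM, lt_iSup_iff] at ha
    obtain ⟨l, hl, hfin, hal⟩ := ha
    have hexp : Tendsto (fun b => ENNReal.ofReal (Real.exp (l * b))) (nhdsWithin d (Set.Ioi d))
        (nhds (ENNReal.ofReal (Real.exp (l * d)))) :=
      ((ENNReal.continuous_ofReal.comp (by fun_prop)).tendsto d).mono_left nhdsWithin_le_nhds
    have hmul : Tendsto (fun b => ν (Set.Ioo d b) * ENNReal.ofReal (Real.exp (l * b)))
        (nhdsWithin d (Set.Ioi d)) (nhds 0) := by
      simpa using ENNReal.Tendsto.mul hp (Or.inr ENNReal.ofReal_ne_top) hexp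
        (Or.inr ENNReal.zero_ne_top)
    have hlow : Tendsto (fun b => (mgfM ν l - ν (Set.Ioo d b) *
        ENNReal.ofReal (Real.exp (l * b))) / (1 - ν (Set.Ioo d b)))
        (nhdsWithin d (Set.Ioi d)) (nhds (mgfM ν l)) := by
      simpa using ENNReal.Tendsto.div
        (ENNReal.Tendsto.sub tendsto_const_nhds hmul (Or.inl hfin.ne))
        (Or.inr one_ne_zero) hsub (Or.inl (by simp))
    filter_upwards [hlow.eventually_const_lt hal, hlt] with b hb hb1
    refine hb.trans_le ((le_mgfM_cond_compl ν measurableSet_Ioo (fun x hx => hx.2.le)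
      hl.le).trans (mgfM_le_LsupM hl ?_))
    exact (mgfM_cond_compl_le ν measurableSet_Ioo l).trans_lt
      (ENNReal.div_lt_top hfin.ne (tsub_pos_of_lt hb1).ne')
  · have hup : Tendsto (fun b => LsupM ν / (1 - ν (Set.Ioo d b)))
        (nhdsWithin d (Set.Ioi d)) (nhds (LsupM ν)) := by
      simpa using ENNReal.Tendsto.div (tendsto_const_nhds (x := LsupM ν))
        (Or.inr one_ne_zero) hsub (Or.inl ENNReal.one_ne_top)
    filter_upwards [hup.eventually_lt_const ha] with b hb
    exact (LsupM_cond_compl_le ν measurableSet_Ioo (fun x hx => hx.2.le)).trans_lt hb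

lemma mgfM_map {Ω : Type*} [MeasurableSpace Ω] (μ : Measure Ω) {T : Ω → ℝ} (hT : Measurable T)
    (l : ℝ) : mgfM (μ.map T) l = ∫⁻ ω, ENNReal.ofReal (Real.exp (l * T ω)) ∂μ :=
  lintegral_map (by fun_prop) hT

/-- A nonnegative random variable with exponential tails of rate `c` has finite exponential
moments below `c`. -/
lemma mgfM_map_lt_top {Ω : Type*} [MeasurableSpace Ω] (μ : Measure Ω) [IsFiniteMeasure μ]
    {T : Ω → ℝ} (hT : Measurable T) (hT0 : ∀ᵐ ω ∂μ, 0 ≤ T ω) {C c l : ℝ}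
    (h : ∀ t ≥ (0 : ℝ), (μ {ω | t ≤ T ω}).toReal ≤ C * Real.exp (-c * t))
    (hl : 0 < l) (hlc : l < c) : mgfM (μ.map T) l < ⊤ := by
  have hcake := lintegral_comp_eq_lintegral_meas_le_mul μ hT0 hT.aemeasurable
    (g := fun t => l * Real.exp (l * t))
    (fun t _ => Continuous.intervalIntegrable (by fun_prop) _ _)
    (Eventually.of_forall fun t => by positivity)
  have hprim (x : ℝ) : ∫ t in (0 : ℝ)..x, l * Real.exp (l * t) = Real.exp (l * x) - 1 := by
    rw [intervalIntegral.integral_eq_sub_of_hasDerivAt (f := fun t => Real.exp (l * t))]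
    · simp
    · intro t _
      simpa [mul_comm] using ((hasDerivAt_id t).const_mul l).exp
    · exact Continuous.intervalIntegrable (by fun_prop) _ _
  simp only [hprim] at hcake
  have hint : IntegrableOn (fun t => C * l * Real.exp (-(c - l) * t)) (Set.Ioi 0) :=
    (exp_neg_integrableOn_Ioi 0 (sub_pos.2 hlc)).const_mul _
  have hfin : ∫⁻ ω, ENNReal.ofReal (Real.exp (l * T ω) - 1) ∂μ < ⊤ := by
    rw [hcake]
    refine lt_of_le_of_lt (setLIntegral_mono (by fun_prop) fun t ht => ?_) hint.lintegral_lt_top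
    rw [← ENNReal.ofReal_toReal (measure_ne_top μ {a | t ≤ T a}),
      ← ENNReal.ofReal_mul ENNReal.toReal_nonneg]
    refine ENNReal.ofReal_le_ofReal ?_
    calc (μ {ω | t ≤ T ω}).toReal * (l * Real.exp (l * t))
        ≤ C * Real.exp (-c * t) * (l * Real.exp (l * t)) := by
          gcongr
          exact h t (le_of_lt ht)
      _ = C * l * Real.exp (-(c - l) * t) := by
          rw [show -(c - l) * t = -c * t + l * t by ring, Real.exp_add]
          ring
  rw [mgfM_map μ hT]
  calc ∫⁻ ω, ENNReal.ofReal (Real.exp (l * T ω)) ∂μ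
      ≤ ∫⁻ ω, (ENNReal.ofReal (Real.exp (l * T ω) - 1) + 1) ∂μ := by
        refine lintegral_mono fun ω => ?_
        rw [← ENNReal.ofReal_one]
        refine le_trans (ENNReal.ofReal_le_ofReal ?_) ENNReal.ofReal_add_le
        simp
    _ = ∫⁻ ω, ENNReal.ofReal (Real.exp (l * T ω) - 1) ∂μ + μ Set.univ := by
        rw [lintegral_add_right _ measurable_const, lintegral_one]
    _ < ⊤ := ENNReal.add_lt_top.2 ⟨hfin, measure_lt_top _ _⟩

lemma one_lt_mgfM_map {Ω : Type*} [MeasurableSpace Ω] (μ : Measure Ω) [IsProbabilityMeasure μ]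
    {T : Ω → ℝ} (hT : Measurable T) (hTpos : ∀ᵐ ω ∂μ, 0 < T ω) {l : ℝ} (hl : 0 < l) :
    1 < mgfM (μ.map T) l := by
  rw [mgfM_map μ hT]
  calc (1 : ENNReal) = ∫⁻ _, 1 ∂μ := by simp
    _ < ∫⁻ ω, ENNReal.ofReal (Real.exp (l * T ω)) ∂μ := by
      refine lintegral_strict_mono (IsProbabilityMeasure.ne_zero μ) (by fun_prop) (by simp) ?_
      filter_upwards [hTpos] with ω hω
      simpa using mul_pos hl hω

/-- Let `T` be a jump distribution with exponential tails, absolutely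
continuous with a continuous density `g`, and let `d > 0` with `g d > 0`. For `d′ > d` put
`A_{d′} := (d, d′)` and `p_{d′} := ℙ(T ∈ A_{d′})`. Then for all `γ ≥ 0` and `d′ > d` with
`p_{d′} < 1`,
`(E[e^{γT}] − p_{d′}·e^{γd′})/(1−p_{d′}) ≤ E[e^{γ·T|_{A_{d′}^c}}] ≤ E[e^{γT}]/(1−p_{d′})`;
consequently `p_{d′} → 0` and `𝓛(T|_{A_{d′}^c}) → 𝓛(T)` as `d′ ↓ d`, and in particular there is
`d′ > d` with `p_{d′} < 1 − 1/𝓛(T|_{A_{d′}^c})`. -/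
theorem conditional_mgf_bounds_and_limit
    {Ω : Type*} [MeasurableSpace Ω] (μ : Measure Ω) [IsProbabilityMeasure μ]
    (T : Ω → ℝ) (hT : Measurable T) (hTpos : ∀ᵐ ω ∂μ, 0 < T ω)
    (hexp : ∃ C c : ℝ, 0 < C ∧ 0 < c ∧
      ∀ t ≥ (0:ℝ), (μ {ω | t ≤ T ω}).toReal ≤ C * Real.exp (-c * t))
    (g : ℝ → ℝ) (hgc : Continuous g)
    (hgd : Measure.map T μ = volume.withDensity fun s => ENNReal.ofReal (g s))
    (d : ℝ) (hd : 0 < d) (hgdpos : 0 < g d) :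
    (∀ γ ≥ (0:ℝ), ∀ d' > d, μ {ω | T ω ∈ Set.Ioo d d'} < 1 →
      (mgfM (Measure.map T μ) γ
            - μ {ω | T ω ∈ Set.Ioo d d'} * ENNReal.ofReal (Real.exp (γ * d')))
          / (1 - μ {ω | T ω ∈ Set.Ioo d d'})
        ≤ mgfM (ProbabilityTheory.cond (Measure.map T μ) (Set.Ioo d d')ᶜ) γ ∧
      mgfM (ProbabilityTheory.cond (Measure.map T μ) (Set.Ioo d d')ᶜ) γ
        ≤ mgfM (Measure.map T μ) γ / (1 - μ {ω | T ω ∈ Set.Ioo d d'})) ∧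
    Tendsto (fun d' => μ {ω | T ω ∈ Set.Ioo d d'}) (nhdsWithin d (Set.Ioi d)) (nhds 0) ∧
    Tendsto (fun d' => LsupM (ProbabilityTheory.cond (Measure.map T μ) (Set.Ioo d d')ᶜ))
      (nhdsWithin d (Set.Ioi d)) (nhds (LsupM (Measure.map T μ))) ∧
    ∃ d' > d, μ {ω | T ω ∈ Set.Ioo d d'}
        < 1 - (LsupM (ProbabilityTheory.cond (Measure.map T μ) (Set.Ioo d d')ᶜ))⁻¹ := by
  have := Measure.isProbabilityMeasure_map (μ := μ) hT.aemeasurable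
  have hp (d' : ℝ) : μ {ω | T ω ∈ Set.Ioo d d'} = μ.map T (Set.Ioo d d') :=
    (Measure.map_apply hT measurableSet_Ioo).symm
  simp only [hp]
  have hp0 := tendsto_measure_Ioo_right (μ.map T) d
  have hL := tendsto_LsupM_cond_compl_Ioo (μ.map T) d
  refine ⟨fun γ hγ d' _ _ => ⟨le_mgfM_cond_compl _ measurableSet_Ioo (fun x hx => hx.2.le) hγ,
    mgfM_cond_compl_le _ measurableSet_Ioo γ⟩, hp0, hL, ?_⟩
  obtain ⟨C, c, -, hc, htail⟩ := hexp
  have hfin : mgfM (μ.map T) (c / 2) < ⊤ :=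
    mgfM_map_lt_top μ hT (hTpos.mono fun _ h => h.le) htail (half_pos hc) (half_lt_self hc)
  have hL1 : 1 < LsupM (μ.map T) :=
    (one_lt_mgfM_map μ hT hTpos (half_pos hc)).trans_le (mgfM_le_LsupM (half_pos hc) hfin)
  have hgap := ENNReal.Tendsto.sub (tendsto_const_nhds (x := (1 : ENNReal)))
    (tendsto_inv_iff.2 hL) (Or.inl ENNReal.one_ne_top)
  have hev := hp0.eventually_lt hgap (tsub_pos_of_lt (ENNReal.inv_lt_one.2 hL1))
  obtain ⟨d', hlt, hd'⟩ := (hev.and self_mem_nhdsWithin).exists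
  exact ⟨d', hd', hlt⟩
end
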